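/- Let 0 ≤ e ≤ h−1, let C_i be an [n,k_i,d_i]_q linear code with 0 < k_i < n and Euclidean dual distance d_i^{⊥E} for i = 1,…,s, and let A be an s×s non-singular by columns (NSC) Toeplitz matrix over F_q. Let M_{τ'} be an n×n monomial matrix and σ' = (M_{τ'}, e). Suppose: (1) there is an s×s monomial matrix M over F_q and an s×s diagonal matrix D over F_q such that π_e(A)·M·A = D·Q; (2) σ = (M_τ, e) with M_τ = (M·Q) ⊗ M_{τ'}, and every C_i is σ' self-orthogonal. Then C(A) = [C_1,…,C_s]·A is a σ self-orthogonal code of length sn, dimension Σ_{i=1}^s k_i, and minimum distance at least min{(s+1−i)·d_i : 1 ≤ i ≤ s}; moreover C(A)^{⊥σ} has dimension sn − Σ_{i=1}^s k_i and minimum distance at least min{i·d_i^{⊥E} : 1 ≤ i ≤ s}. -/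

import Mathlib

open Matrix Finset Kronecker

variable {F : Type} [Field F] [DecidableEq F]

/-- Entrywise application of the map `π_e : x ↦ x ^ (p ^ e)` to a matrix. -/
def piE (p e : ℕ) {m n : Type} (A : Matrix m n F) : Matrix m n F :=
  A.map fun x => x ^ p ^ e

/-- Entrywise application of `π_e` to a vector. -/
def piEv (p e : ℕ) {n : Type} (v : n → F) : n → F := fun i => v i ^ p ^ e

/-- A monomial matrix: exactly one nonzero entry in each row and each column. -/
def IsMonomial {n : Type} [Fintype n] (M : Matrix n n F) : Prop :=
  (∀ i, ∃! j, M i j ≠ 0) ∧ (∀ j, ∃! i, M i j ≠ 0)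

/-- Non-singular by columns (NSC): for each `ℓ`, every `ℓ × ℓ` submatrix formed by the first
`ℓ` rows and any `ℓ` columns (in increasing order) is non-singular. -/
def IsNSC {s : ℕ} (A : Matrix (Fin s) (Fin s) F) : Prop :=
  ∀ (ℓ : ℕ) (hℓ : ℓ ≤ s) (j : Fin ℓ → Fin s), StrictMono j →
    (Matrix.of fun a b : Fin ℓ => A (Fin.castLE hℓ a) (j b)).det ≠ 0

/-- Toeplitz matrix: constant along diagonals. -/
def IsToeplitz {s : ℕ} (A : Matrix (Fin s) (Fin s) F) : Prop :=
  ∀ (i j : ℕ) (hi : i + 1 < s) (hj : j + 1 < s),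
    A ⟨i, Nat.lt_of_succ_lt hi⟩ ⟨j, Nat.lt_of_succ_lt hj⟩ = A ⟨i + 1, hi⟩ ⟨j + 1, hj⟩

/-- The anti-diagonal matrix `Q` with ones on the anti-diagonal. -/
def antiDiagQ (F : Type) [Field F] (s : ℕ) : Matrix (Fin s) (Fin s) F :=
  Matrix.of fun i j => if (i : ℕ) + (j : ℕ) + 1 = s then 1 else 0

/-- Dual of a code with respect to the pairing `⟨u, c⟩ = ∑ j, u j * g c j`. -/
def dualWith {n : Type} [Fintype n] (g : (n → F) → n → F) (C : Submodule F (n → F)) :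
    Submodule F (n → F) where
  carrier := {u | ∀ c ∈ C, ∑ j, u j * g c j = 0}
  add_mem' := by
    intro a b ha hb c hc
    simp only [Pi.add_apply, add_mul, Finset.sum_add_distrib, ha c hc, hb c hc, add_zero]
  zero_mem' := by
    intro c hc
    simp
  smul_mem' := by
    intro r a ha c hc
    simp only [Pi.smul_apply, smul_eq_mul, mul_assoc, ← Finset.mul_sum, ha c hc, mul_zero]

/-- The `σ = (M, e)` dual of a linear code. -/
def sigmaDual {n : Type} [Fintype n] (p e : ℕ) (M : Matrix n n F)
    (C : Submodule F (n → F)) : Submodule F (n → F) :=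
  dualWith (fun c => Matrix.vecMul (piEv p e c) M) C

/-- The Euclidean dual of a linear code. -/
def euclidDual {n : Type} [Fintype n] (C : Submodule F (n → F)) : Submodule F (n → F) :=
  dualWith id C

/-- The matrix-product code `[C_1, …, C_s] · A`, realized inside `Fin s × Fin n → F`
(block `j` of a codeword is `∑ i, A i j • c i`). -/
def matrixProductCode {n s : ℕ} (C : Fin s → Submodule F (Fin n → F))
    (A : Matrix (Fin s) (Fin s) F) : Submodule F (Fin s × Fin n → F) where
  carrier := {x | ∃ c : Fin s → Fin n → F, (∀ i, c i ∈ C i) ∧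
    ∀ jt : Fin s × Fin n, x jt = ∑ i, A i jt.1 * c i jt.2}
  add_mem' := by
    rintro x y ⟨c, hc, hx⟩ ⟨d, hd, hy⟩
    refine ⟨c + d, fun i => (C i).add_mem (hc i) (hd i), fun jt => ?_⟩
    simp [hx jt, hy jt, mul_add, Finset.sum_add_distrib]
  zero_mem' := ⟨0, fun i => (C i).zero_mem, fun jt => by simp⟩
  smul_mem' := by
    rintro r x ⟨c, hc, hx⟩
    refine ⟨r • c, fun i => (C i).smul_mem r (hc i), fun jt => ?_⟩
    simp [hx jt, Finset.mul_sum, mul_left_comm]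

/-- The minimum distance of the code `C` is at least `d`. -/
def minDistGe {n : Type} [Fintype n] (C : Submodule F (n → F)) (d : ℕ) : Prop :=
  ∀ x ∈ C, x ≠ 0 → d ≤ hammingNorm x

/-- The code `C` has minimum distance exactly `d`. -/
def minDistEq {n : Type} [Fintype n] (C : Submodule F (n → F)) (d : ℕ) : Prop :=
  minDistGe C d ∧ ∃ x ∈ C, x ≠ 0 ∧ hammingNorm x = d

set_option linter.unusedSectionVars false

theorem antiDiagQ_apply {s : ℕ} (i j : Fin s) :
    antiDiagQ F s i j = if i.rev = j then 1 else 0 := by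
  have : (i : ℕ) + j + 1 = s ↔ i.rev = j := by
    rw [Fin.ext_iff, Fin.val_rev]; omega
  simp [antiDiagQ, this]

theorem mul_antiDiagQ_apply {m : Type} {s : ℕ} (B : Matrix m (Fin s) F) (i : m) (j : Fin s) :
    (B * antiDiagQ F s) i j = B i j.rev := by
  have (l : Fin s) : l.rev = j ↔ l = j.rev := Fin.rev_eq_iff
  simp [Matrix.mul_apply, antiDiagQ_apply, this]

theorem antiDiagQ_mul_apply {m : Type} {s : ℕ} (B : Matrix (Fin s) m F) (i : Fin s) (j : m) :
    (antiDiagQ F s * B) i j = B i.rev j := by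
  simp [Matrix.mul_apply, antiDiagQ_apply]

theorem antiDiagQ_mul_self (s : ℕ) : antiDiagQ F s * antiDiagQ F s = 1 := by
  ext i j
  simp [mul_antiDiagQ_apply, antiDiagQ_apply, Matrix.one_apply]

theorem IsToeplitz.apply_add {s : ℕ} {A : Matrix (Fin s) (Fin s) F} (hT : IsToeplitz A) (k : ℕ)
    (i j : ℕ) (hi : i + k < s) (hj : j + k < s) :
    A ⟨i, by omega⟩ ⟨j, by omega⟩ = A ⟨i + k, hi⟩ ⟨j + k, hj⟩ := by
  induction k with
  | zero => rfl
  | succ k ih => rw [ih (by omega) (by omega)]; exact hT _ _ hi hj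

/-- A Toeplitz matrix is symmetric about its anti-diagonal. -/
theorem IsToeplitz.apply_rev {s : ℕ} {A : Matrix (Fin s) (Fin s) F} (hT : IsToeplitz A)
    (i j : Fin s) : A j.rev i.rev = A i j := by
  have key (a b : ℕ) (ha : a < s) (hb : b < s) :
      A ⟨s - 1 - b, by omega⟩ ⟨s - 1 - a, by omega⟩ = A ⟨a, ha⟩ ⟨b, hb⟩ := by
    rcases le_total (a + b) (s - 1) with h | h
    · rw [hT.apply_add (s - 1 - (a + b)) a b (by omega) (by omega)]
      congr 2 <;> omega
    · rw [hT.apply_add (a + b - (s - 1)) (s - 1 - b) (s - 1 - a) (by omega) (by omega)]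
      congr 2 <;> omega
  have hr (l : Fin s) : l.rev = ⟨s - 1 - l, by omega⟩ := by
    ext; rw [Fin.val_rev]; dsimp only; omega
  rw [hr, hr]
  exact key i j i.2 j.2

theorem IsToeplitz.antiDiagQ_mul_transpose {s : ℕ} {A : Matrix (Fin s) (Fin s) F}
    (hT : IsToeplitz A) : antiDiagQ F s * Aᵀ = A * antiDiagQ F s := by
  ext i j
  rw [antiDiagQ_mul_apply, mul_antiDiagQ_apply, Matrix.transpose_apply, ← hT.apply_rev i j.rev,
    Fin.rev_rev]

theorem hammingNorm_prod {s n : ℕ} (x : Fin s × Fin n → F) :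
    hammingNorm x = ∑ t, hammingNorm fun j => x (j, t) := by
  simp only [hammingNorm, Finset.card_filter]
  exact Fintype.sum_prod_type_right _

theorem mul_hammingNorm_le {s n m : ℕ} (x : Fin s × Fin n → F) (c : Fin n → F)
    (h : ∀ t, c t ≠ 0 → m ≤ hammingNorm fun j => x (j, t)) :
    m * hammingNorm c ≤ hammingNorm x := by
  rw [hammingNorm_prod, mul_comm, hammingNorm, ← smul_eq_mul]
  refine (Finset.card_nsmul_le_sum _ _ m fun t ht => h t (Finset.mem_filter.mp ht).2).trans ?_
  exact Finset.sum_le_sum_of_subset (Finset.subset_univ _)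

theorem sum_castLE_of_eq_zero {s l : ℕ} (hl : l ≤ s) (f : Fin s → F)
    (hf : ∀ i : Fin s, l ≤ i → f i = 0) : ∑ a : Fin l, f (Fin.castLE hl a) = ∑ i, f i := by
  refine Fintype.sum_of_injective (Fin.castLE hl) (Fin.castLE_injective hl) _ _ ?_ fun _ => rfl
  intro i hi
  refine hf i (not_lt.mp fun h => hi ⟨⟨i, h⟩, rfl⟩)

/-- A nonzero combination of the first `r + 1` rows of an NSC matrix vanishes in at most `r`
columns. -/
theorem IsNSC.le_hammingNorm_row {s : ℕ} {A : Matrix (Fin s) (Fin s) F} (hA : IsNSC A)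
    (c : Fin s → F) (r : Fin s) (hc : ∀ i, r < i → c i = 0) (hr : c r ≠ 0) :
    s - r ≤ hammingNorm fun j => ∑ i, A i j * c i := by
  by_contra! hlt
  set y : Fin s → F := fun j => ∑ i, A i j * c i with hy
  have hcard := Finset.card_filter_add_card_filter_not (s := (Finset.univ : Finset (Fin s)))
    fun j => y j ≠ 0
  have hlt' : (Finset.univ.filter fun j => y j ≠ 0).card < s - r := hlt
  rw [Finset.card_univ, Fintype.card_fin] at hcard
  obtain ⟨T, hTs, hT⟩ := Finset.exists_subset_card_eq
    (show (r : ℕ) + 1 ≤ (Finset.univ.filter fun j => ¬ y j ≠ 0).card by omega)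
  have hdet := hA (r + 1) r.2 (T.orderEmbOfFin hT) (T.orderEmbOfFin hT).strictMono
  have h0 := Matrix.eq_zero_of_vecMul_eq_zero hdet
    (v := fun a => c (Fin.castLE r.2 a)) (by
      ext b
      have hb := (Finset.mem_filter.mp (hTs (T.orderEmbOfFin_mem hT b))).2
      rw [not_not] at hb
      rw [Pi.zero_apply, ← hb]
      simp only [Matrix.vecMul, dotProduct, Matrix.of_apply, hy, mul_comm (A _ _)]
      exact sum_castLE_of_eq_zero r.2 (fun i => c i * A i (T.orderEmbOfFin hT b))
        fun i hi => by rw [hc i (Fin.lt_def.mpr hi), zero_mul])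
  exact hr (congrFun h0 (Fin.last r))

/-- A nonzero vector orthogonal to the first `r` rows of an NSC matrix has weight more
than `r`. -/
theorem IsNSC.le_hammingNorm_of_orthogonal {s : ℕ} {A : Matrix (Fin s) (Fin s) F} (hA : IsNSC A)
    (v : Fin s → F) (hv : v ≠ 0) (r : Fin s) (hr : ∀ i < r, ∑ j, A i j * v j = 0) :
    r + 1 ≤ hammingNorm v := by
  by_contra! hlt
  obtain ⟨T, hTs, hT⟩ := Finset.exists_superset_card_eq (n := r)
    (s := Finset.univ.filter fun j => v j ≠ 0) (Nat.lt_succ_iff.mp hlt) (by simp [r.2.le])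
  have hsupp (j : Fin s) (hj : j ∉ T) : v j = 0 := by
    by_contra h
    exact hj (hTs (by simpa using h))
  have hrange (j : Fin s) : j ∈ Set.range (T.orderEmbOfFin hT) ↔ j ∈ T := by
    rw [Finset.range_orderEmbOfFin, Finset.mem_coe]
  have hdet := hA r r.2.le (T.orderEmbOfFin hT) (T.orderEmbOfFin hT).strictMono
  have h0 := Matrix.eq_zero_of_mulVec_eq_zero hdet
    (v := fun b => v (T.orderEmbOfFin hT b)) (by
      ext a
      rw [Pi.zero_apply, ← hr (Fin.castLE r.2.le a) (Fin.lt_def.mpr a.2)]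
      simp only [Matrix.mulVec, dotProduct, Matrix.of_apply]
      refine Fintype.sum_of_injective _ (T.orderEmbOfFin hT).injective _ _ ?_ fun _ => rfl
      intro j hj
      rw [hsupp j (mt (hrange j).mpr hj), mul_zero])
  refine hv (funext fun j => ?_)
  by_cases hj : j ∈ T
  · obtain ⟨b, rfl⟩ := (hrange j).mpr hj
    exact congrFun h0 b
  · exact hsupp j hj

theorem IsNSC.eq_zero_of_sum_eq_zero {s : ℕ} {A : Matrix (Fin s) (Fin s) F} (hA : IsNSC A)
    (c : Fin s → F) (hc : ∀ j, ∑ i, A i j * c i = 0) : c = 0 := by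
  refine Matrix.eq_zero_of_vecMul_eq_zero (M := A) (hA s le_rfl id strictMono_id) ?_
  ext j
  simpa [Matrix.vecMul, dotProduct, mul_comm] using hc j

theorem finrank_matrixProductCode {n s : ℕ} (C : Fin s → Submodule F (Fin n → F))
    {A : Matrix (Fin s) (Fin s) F} (hA : IsNSC A) :
    Module.finrank F (matrixProductCode C A) = ∑ i, Module.finrank F (C i) := by
  let f : ((i : Fin s) → C i) →ₗ[F] (Fin s × Fin n → F) :=
    { toFun := fun c jt => ∑ i, A i jt.1 * (c i : Fin n → F) jt.2
      map_add' := fun c d => by ext; simp [mul_add, Finset.sum_add_distrib]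
      map_smul' := fun r c => by ext; simp [Finset.mul_sum, mul_left_comm] }
  have hinj : Function.Injective f := by
    rw [injective_iff_map_eq_zero]
    intro c hc
    ext i t
    exact congrFun (hA.eq_zero_of_sum_eq_zero (fun i => (c i : Fin n → F) t)
      fun j => congrFun hc (j, t)) i
  have hrange : LinearMap.range f = matrixProductCode C A := by
    ext x
    constructor
    · rintro ⟨c, rfl⟩
      exact ⟨fun i => c i, fun i => (c i).2, fun _ => rfl⟩
    · rintro ⟨c, hc, hx⟩
      exact ⟨fun i => ⟨c i, hc i⟩, funext fun jt => (hx jt).symm⟩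
  rw [← hrange, LinearMap.finrank_range_of_inj hinj, Module.finrank_pi_fintype]

theorem minDistGe_matrixProductCode {n s : ℕ} [Nonempty (Fin s)]
    {C : Fin s → Submodule F (Fin n → F)}
    {d : Fin s → ℕ} (hd : ∀ i, minDistGe (C i) (d i)) {A : Matrix (Fin s) (Fin s) F}
    (hA : IsNSC A) :
    minDistGe (matrixProductCode C A)
      (Finset.univ.inf' Finset.univ_nonempty fun i : Fin s => (s - (i : ℕ)) * d i) := by
  rintro x ⟨c, hc, hx⟩ hx0
  have hne : (Finset.univ.filter fun i => c i ≠ 0).Nonempty := by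
    by_contra! h
    refine hx0 (funext fun jt => ?_)
    have hz (i : Fin s) : c i = 0 := by
      by_contra hi
      exact Finset.notMem_empty i (h ▸ Finset.mem_filter.mpr ⟨Finset.mem_univ i, hi⟩)
    simp [hx, hz]
  obtain ⟨r, hr, hmax⟩ := Finset.exists_max_image _ id hne
  have hr0 := (Finset.mem_filter.mp hr).2
  refine (Finset.inf'_le _ (Finset.mem_univ r)).trans
    ((Nat.mul_le_mul_left _ (hd r _ (hc r) hr0)).trans (mul_hammingNorm_le x (c r) fun t ht => ?_))
  simp only [hx]
  refine hA.le_hammingNorm_row (fun i => c i t) r (fun i hi => ?_) ht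
  by_contra h
  exact absurd (hmax i (by simpa using fun h' => h (by simp [h']))) (not_le.mpr hi)

theorem minDistGe_euclidDual_matrixProductCode {n s : ℕ} [Nonempty (Fin s)]
    {C : Fin s → Submodule F (Fin n → F)}
    {d : Fin s → ℕ} (hd : ∀ i, minDistGe (euclidDual (C i)) (d i))
    {A : Matrix (Fin s) (Fin s) F} (hA : IsNSC A) :
    minDistGe (euclidDual (matrixProductCode C A))
      (Finset.univ.inf' Finset.univ_nonempty fun i : Fin s => ((i : ℕ) + 1) * d i) := by
  intro v hv hv0
  let w (i : Fin s) (t : Fin n) : F := ∑ j, A i j * v (j, t)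
  have hw (i : Fin s) : w i ∈ euclidDual (C i) := by
    intro c hc
    have := hv (fun jt => A i jt.1 * c jt.2) ⟨Pi.single i c, fun l => by
      by_cases h : l = i
      · subst h; simpa using hc
      · simp [h], fun jt => by
        rw [Finset.sum_eq_single i] <;> simp +contextual⟩
    rw [← this, Fintype.sum_prod_type_right]
    refine Finset.sum_congr rfl fun t _ => ?_
    simp only [w, id, Finset.sum_mul]
    exact Finset.sum_congr rfl fun j _ => by ring
  have hne : (Finset.univ.filter fun i => w i ≠ 0).Nonempty := by
    by_contra! h
    refine hv0 (funext fun ⟨j, t⟩ => ?_)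
    have hz (i : Fin s) : w i = 0 := by
      by_contra hi
      exact Finset.notMem_empty i (h ▸ Finset.mem_filter.mpr ⟨Finset.mem_univ i, hi⟩)
    exact congrFun (Matrix.eq_zero_of_mulVec_eq_zero (M := A) (hA s le_rfl id strictMono_id)
      (v := fun j => v (j, t)) (funext fun i => congrFun (hz i) t)) j
  obtain ⟨r, hr, hmin⟩ := Finset.exists_min_image _ id hne
  have hr0 := (Finset.mem_filter.mp hr).2
  refine (Finset.inf'_le _ (Finset.mem_univ r)).trans
    ((Nat.mul_le_mul_left _ (hd r _ (hw r) hr0)).trans (mul_hammingNorm_le v (w r) fun t ht => ?_))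
  refine hA.le_hammingNorm_of_orthogonal _ (fun h => ht ?_) r fun i hi => ?_
  · have (j : Fin s) : v (j, t) = 0 := congrFun h j
    simp [w, this]
  · by_contra h
    exact absurd (hmin i (Finset.mem_filter.mpr
      ⟨Finset.mem_univ i, fun h' => h (congrFun h' t)⟩)) (not_le.mpr hi)

theorem finrank_euclidDual {ι : Type} [Fintype ι] [DecidableEq ι] (C : Submodule F (ι → F)) :
    Module.finrank F C + Module.finrank F (euclidDual C) = Fintype.card ι := by
  have h : (euclidDual C).map (dotProductEquiv F ι).toLinearMap = C.dualAnnihilator := by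
    rw [Submodule.map_equiv_eq_comap_symm]
    ext φ
    obtain ⟨u, rfl⟩ := (dotProductEquiv F ι).surjective φ
    simp only [Submodule.mem_comap, LinearEquiv.coe_coe, LinearEquiv.symm_apply_apply,
      Submodule.mem_dualAnnihilator]
    exact Iff.rfl
  rw [← LinearEquiv.finrank_map_eq (dotProductEquiv F ι) (euclidDual C), h,
    Subspace.finrank_add_finrank_dualAnnihilator_eq, Module.finrank_fintype_fun_eq_card]

theorem IsMonomial.exists_perm {ι : Type} [Fintype ι] [DecidableEq ι] {M : Matrix ι ι F}
    (hM : IsMonomial M) : ∃ (f : Equiv.Perm ι) (a : ι → F), (∀ i, a i ≠ 0) ∧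
      ∀ i j, M i j = if f i = j then a i else 0 := by
  choose f hf hf' using hM.1
  have hinj : Function.Injective f := fun i i' h =>
    (hM.2 (f i)).unique (hf i) (by rw [h]; exact hf i')
  refine ⟨Equiv.ofBijective f (Finite.injective_iff_bijective.mp hinj), fun i => M i (f i), hf,
    fun i j => ?_⟩
  simp only [Equiv.ofBijective_apply]
  split_ifs with h
  · rw [h]
  · by_contra h0
    exact h (hf' i j h0).symm

/-- A monomial matrix up to an automorphism of the field maps the `σ` dual bijectively onto the
Euclidean dual, preserving weights. -/
theorem exists_equiv_sigmaDual {ι : Type} [Fintype ι] [DecidableEq ι] {p e : ℕ} (φ : F ≃+* F)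
    (hφ : ∀ x, φ x = x ^ p ^ e) {M : Matrix ι ι F} (f : Equiv.Perm ι) {a : ι → F}
    (ha : ∀ i, a i ≠ 0) (hM : ∀ i j, M i j = if f i = j then a i else 0)
    (C : Submodule F (ι → F)) :
    ∃ U : (ι → F) ≃ (ι → F), U 0 = 0 ∧ (∀ u, hammingNorm (U u) = hammingNorm u) ∧
      ∀ u, U u ∈ euclidDual C ↔ u ∈ sigmaDual p e M C := by
  let U : (ι → F) ≃ (ι → F) :=
    { toFun := fun u i => φ.symm (a i * u (f i))
      invFun := fun w j => (a (f.symm j))⁻¹ * φ (w (f.symm j))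
      left_inv := fun u => by ext j; simp [ha]
      right_inv := fun w => by ext i; simp [ha] }
  have hU (u : ι → F) (i : ι) : U u i = φ.symm (a i * u (f i)) := rfl
  refine ⟨U, by ext i; simp [hU], fun u => ?_, fun u => ?_⟩
  · simp only [hammingNorm]
    refine Finset.card_equiv f fun i => ?_
    simp [hU, ha]
  · refine forall₂_congr fun c _ => ?_
    have key : φ (∑ i, U u i * c i) = ∑ j, u j * vecMul (piEv p e c) M j := by
      rw [map_sum, ← Equiv.sum_comp f fun j => u j * vecMul (piEv p e c) M j]
      refine Finset.sum_congr rfl fun i _ => ?_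
      have hv : vecMul (piEv p e c) M (f i) = φ (c i) * a i := by
        simp [vecMul, dotProduct, hM, piEv, hφ]
      rw [hv, map_mul, hU, RingEquiv.apply_symm_apply]
      ring
    change ∑ i, U u i * c i = 0 ↔ ∑ j, u j * vecMul (piEv p e c) M j = 0
    rw [← key, map_eq_zero_iff φ φ.injective]

theorem finrank_eq_of_equiv [Finite F] {ι : Type} [Finite ι] {C D : Submodule F (ι → F)}
    (U : (ι → F) ≃ (ι → F)) (hU : ∀ u, U u ∈ D ↔ u ∈ C) :
    Module.finrank F C = Module.finrank F D := by
  have h : Nat.card C = Nat.card D := Nat.card_congr (U.subtypeEquiv fun u => (hU u).symm)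
  rw [Module.natCard_eq_pow_finrank (K := F) (V := C),
    Module.natCard_eq_pow_finrank (K := F) (V := D)] at h
  exact Nat.pow_right_injective Finite.one_lt_card h

theorem exists_ringEquiv_eq_pow [Fintype F] {p h : ℕ} (hp : p.Prime)
    (hcard : Fintype.card F = p ^ h) (e : ℕ) : ∃ φ : F ≃+* F, ∀ x, φ x = x ^ p ^ e := by
  have : Fact p.Prime := ⟨hp⟩
  have : CharP F p := charP_of_card_eq_prime_pow hcard
  exact ⟨iterateFrobeniusEquiv F p e, iterateFrobeniusEquiv_def F p e⟩

theorem matrixProductCode_le_sigmaDual {p e n s : ℕ} (φ : F ≃+* F) (hφ : ∀ x, φ x = x ^ p ^ e)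
    {C : Fin s → Submodule F (Fin n → F)} {A N : Matrix (Fin s) (Fin s) F} {D : Fin s → F}
    {M' : Matrix (Fin n) (Fin n) F} (hN : piE p e A * N * Aᵀ = Matrix.diagonal D)
    (hC : ∀ i, C i ≤ sigmaDual p e M' (C i)) :
    matrixProductCode C A ≤ sigmaDual p e (N ⊗ₖ M') (matrixProductCode C A) := by
  rintro x ⟨c, hc, hx⟩ y ⟨b, hb, hy⟩
  have hσ (j : Fin s) (t : Fin n) : vecMul (piEv p e y) (N ⊗ₖ M') (j, t) =
      ∑ i, (piE p e A * N) i j * vecMul (piEv p e (b i)) M' t := by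
    simp only [vecMul, dotProduct, piEv, hy, ← hφ, map_sum, map_mul, Finset.sum_mul]
    rw [Finset.sum_comm]
    refine Finset.sum_congr rfl fun i _ => ?_
    rw [Matrix.mul_apply, Finset.sum_mul_sum, Fintype.sum_prod_type]
    refine Finset.sum_congr rfl fun l _ => Finset.sum_congr rfl fun z _ => ?_
    simp only [kroneckerMap_apply, piE, Matrix.map_apply, hφ]
    ring
  have hN' (i l : Fin s) : ∑ j, (piE p e A * N) i j * A l j = if i = l then D i else 0 := by
    rw [← Matrix.diagonal_apply, ← hN, Matrix.mul_apply]
    rfl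
  calc ∑ jt, x jt * vecMul (piEv p e y) (N ⊗ₖ M') jt
      = ∑ i, ∑ l, (∑ j, (piE p e A * N) i j * A l j) *
          ∑ t, c l t * vecMul (piEv p e (b i)) M' t := by
        simp only [hσ, hx, Finset.sum_mul_sum]
        rw [Finset.sum_comm]
        conv_rhs => rw [Finset.sum_comm]
        refine Finset.sum_congr rfl fun l _ => ?_
        rw [Finset.sum_comm]
        refine Finset.sum_congr rfl fun i _ => ?_
        rw [Fintype.sum_prod_type]
        exact Finset.sum_congr rfl fun j _ => Finset.sum_congr rfl fun t _ => by ring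
    _ = 0 := by
        simp only [hN', ite_mul, zero_mul, Finset.sum_ite_eq, Finset.mem_univ, if_true]
        exact Finset.sum_eq_zero fun i _ => by rw [hC i (hc i) (b i) (hb i), mul_zero]

/-- Construction III: if `A` is an NSC Toeplitz matrix with
`π_e(A)·M·A = D·Q` for a monomial `M` and diagonal `D`, and all `C_i` are `σ'`
self-orthogonal, then `C(A)` is a `σ` self-orthogonal `[sn, ∑ k_i, ≥ min (s+1-i)d_i]` code
(with `σ = ((M·Q) ⊗ M_{τ'}, e)`) whose `σ` dual is an `[sn, sn - ∑ k_i, ≥ min i·d_i^{⊥E}]`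
code. -/
theorem stmt8 {p h : ℕ} (hp : p.Prime) (hh : 0 < h)
    {F : Type} [Field F] [Fintype F] [DecidableEq F] (hcard : Fintype.card F = p ^ h)
    (e : ℕ) (he : e < h)
    {n s : ℕ} (hs : 0 < s)
    (C : Fin s → Submodule F (Fin n → F)) (k d dE : Fin s → ℕ)
    (hk : ∀ i, Module.finrank F (C i) = k i)
    (hk0 : ∀ i, 0 < k i) (hkn : ∀ i, k i < n)
    (hd : ∀ i, minDistEq (C i) (d i))
    (hdE : ∀ i, minDistEq (euclidDual (C i)) (dE i))
    (A : Matrix (Fin s) (Fin s) F) (hA : IsNSC A) (hT : IsToeplitz A)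
    (Mτ' : Matrix (Fin n) (Fin n) F) (hMτ' : IsMonomial Mτ')
    (M : Matrix (Fin s) (Fin s) F) (hM : IsMonomial M) (D : Fin s → F)
    (hcond : piE p e A * M * A = Matrix.diagonal D * antiDiagQ F s)
    (hCso : ∀ i, C i ≤ sigmaDual p e Mτ' (C i)) :
    matrixProductCode C A ≤
      sigmaDual p e ((M * antiDiagQ F s) ⊗ₖ Mτ') (matrixProductCode C A) ∧
    Module.finrank F (matrixProductCode C A) = ∑ i, k i ∧
    minDistGe (matrixProductCode C A)
      (Finset.univ.inf' (Finset.univ_nonempty_iff.mpr ⟨⟨0, hs⟩⟩)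
        fun i : Fin s => (s - (i : ℕ)) * d i) ∧
    Module.finrank F
      (sigmaDual p e ((M * antiDiagQ F s) ⊗ₖ Mτ') (matrixProductCode C A)) =
        s * n - ∑ i, k i ∧
    minDistGe (sigmaDual p e ((M * antiDiagQ F s) ⊗ₖ Mτ') (matrixProductCode C A))
      (Finset.univ.inf' (Finset.univ_nonempty_iff.mpr ⟨⟨0, hs⟩⟩)
        fun i : Fin s => ((i : ℕ) + 1) * dE i) := by
  have : Nonempty (Fin s) := ⟨⟨0, hs⟩⟩
  obtain ⟨φ, hφ⟩ := exists_ringEquiv_eq_pow hp hcard e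
  obtain ⟨f, a, ha, hf⟩ := hM.exists_perm
  obtain ⟨f', a', ha', hf'⟩ := hMτ'.exists_perm
  have hdim : Module.finrank F (matrixProductCode C A) = ∑ i, k i := by
    simp only [finrank_matrixProductCode C hA, hk]
  obtain ⟨U, hU0, hUnorm, hU⟩ := exists_equiv_sigmaDual φ hφ
    (M := (M * antiDiagQ F s) ⊗ₖ Mτ') ((f.trans Fin.revPerm).prodCongr f')
    (a := fun i => a i.1 * a' i.2) (fun i => mul_ne_zero (ha _) (ha' _))
    (fun i j => by
      simp only [kroneckerMap_apply, mul_antiDiagQ_apply, hf, hf', Prod.ext_iff,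
        Equiv.prodCongr_apply, Prod.map, Equiv.trans_apply, Fin.revPerm_apply, Fin.rev_eq_iff]
      split_ifs <;> simp_all)
    (matrixProductCode C A)
  refine ⟨matrixProductCode_le_sigmaDual φ hφ (D := D) ?_ hCso, hdim,
    minDistGe_matrixProductCode (fun i => (hd i).1) hA, ?_, fun u hu hu0 => ?_⟩
  · rw [← Matrix.mul_assoc, Matrix.mul_assoc, hT.antiDiagQ_mul_transpose, ← Matrix.mul_assoc,
      hcond, Matrix.mul_assoc, antiDiagQ_mul_self, Matrix.mul_one]
  · have h := finrank_euclidDual (matrixProductCode C A)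
    rw [Fintype.card_prod, Fintype.card_fin, Fintype.card_fin, hdim] at h
    rw [finrank_eq_of_equiv U hU]
    omega
  · rw [← hUnorm u]
    exact minDistGe_euclidDual_matrixProductCode (fun i => (hdE i).1) hA _ ((hU u).mpr hu)
      fun h => hu0 (U.injective (h.trans hU0.symm))
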